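/- arXiv:1701.05432 — 2 statements merged into one kernel-verified Lean document; each statement's English description precedes it below -/
import Mathlib

section
/- For every positive integer n, every σ > 0, and all x, x' ∈ ℝⁿ (with the Euclidean norm ‖·‖), the Gaussian kernel admits the integral expansion exp(-‖x - x'‖²/(2σ²)) = (2/(πσ²))^{n/2} · ∫_{z ∈ ℝⁿ} exp(-‖x - z‖²/σ²) · exp(-‖x' - z‖²/σ²) dz, where the integral is with respect to Lebesgue measure on ℝⁿ. -/
open MeasureTheory Real

/-- Apollonius's identity: the sum of the squared distances from `z` to `x` and `y`, in terms of
the squared distance from `z` to their midpoint. -/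
theorem sq_norm_sub_add_sq_norm_sub_eq {E : Type*} [NormedAddCommGroup E] [InnerProductSpace ℝ E]
    (x y z : E) :
    ‖x - z‖ ^ 2 + ‖y - z‖ ^ 2 =
      2 * ‖z - (1 / 2 : ℝ) • (x + y)‖ ^ 2 + ‖x - y‖ ^ 2 / 2 := by
  have key := parallelogram_law_with_norm ℝ (x - z) (y - z)
  have hsub : x - z - (y - z) = x - y := by abel
  have hadd : x - z + (y - z) = (-2 : ℝ) • (z - (1 / 2 : ℝ) • (x + y)) := by module
  rw [hsub, hadd, norm_smul, norm_neg, Real.norm_ofNat] at key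
  linarith

/-- **Linear Expansion of the Gaussian Kernel** (Theorem 1 of the paper):
for all `x, x'` in `ℝⁿ` and `σ > 0`,
`exp (-‖x - x'‖² / (2σ²)) = (2 / (π σ²))^(n/2) · ∫ z, exp (-‖x - z‖²/σ²) · exp (-‖x' - z‖²/σ²)`. -/
theorem gaussian_kernel_linear_expansion
    (n : ℕ) (hn : 0 < n) (σ : ℝ) (hσ : 0 < σ)
    (x x' : EuclideanSpace ℝ (Fin n)) :
    Real.exp (-(‖x - x'‖ ^ 2) / (2 * σ ^ 2)) =
      (2 / (Real.pi * σ ^ 2)) ^ ((n : ℝ) / 2) *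
        ∫ z : EuclideanSpace ℝ (Fin n),
          Real.exp (-(‖x - z‖ ^ 2) / σ ^ 2) * Real.exp (-(‖x' - z‖ ^ 2) / σ ^ 2) := by
  have hb : 0 < 2 / σ ^ 2 := by positivity
  have hpoint (z : EuclideanSpace ℝ (Fin n)) :
      Real.exp (-(‖x - z‖ ^ 2) / σ ^ 2) * Real.exp (-(‖x' - z‖ ^ 2) / σ ^ 2) =
        Real.exp (-(‖x - x'‖ ^ 2) / (2 * σ ^ 2)) *
          Real.exp (-(2 / σ ^ 2) * ‖z - (1 / 2 : ℝ) • (x + x')‖ ^ 2) := by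
    rw [← Real.exp_add, ← Real.exp_add, ← add_div, ← neg_add,
      sq_norm_sub_add_sq_norm_sub_eq]
    congr 1
    field_simp
    ring
  have hconst : 2 / (Real.pi * σ ^ 2) * (Real.pi / (2 / σ ^ 2)) = 1 := by
    field_simp
  simp_rw [hpoint]
  rw [integral_const_mul,
    integral_sub_right_eq_self (fun z : EuclideanSpace ℝ (Fin n) ↦
      Real.exp (-(2 / σ ^ 2) * ‖z‖ ^ 2)),
    GaussianFourier.integral_rexp_neg_mul_sq_norm hb, finrank_euclideanSpace_fin,
    mul_left_comm, ← Real.mul_rpow (by positivity) (by positivity), hconst, Real.one_rpow, mul_one]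
end

section
/- Let n, d, K, L, r be natural numbers, let x_1, …, x_n and y_1, …, y_n be sequences in ℝ^d, let z_1, …, z_K ∈ ℝ^d with bandwidths σ_1, …, σ_K > 0, let τ_1, …, τ_L ∈ ℝ with bandwidths s_1, …, s_L > 0, and let ζ₁, ζ₂ ≥ 0 and Λ > 0. For x ∈ ℝ^d and t ∈ Fin n define c(x, t) ∈ ℝ^{K+L} whose first K entries are √ζ₁ · exp(-‖x - z_k‖²/σ_k²) for k = 1, …, K and whose last L entries are √ζ₂ · exp(-((t : ℝ) - τ_l)²/s_l²) for l = 1, …, L. Define the HOK descriptor of the sequence x as the tensor HOK(x) : (Fin r → Fin (K+L)) → ℝ with HOK(x)_μ = (1/√Λ) ∑_{t=1}^n ∏_{j=1}^r c(x_t, t)_{μ(j)}, and likewise HOK(y). Then ∑_{μ : Fin r → Fin (K+L)} HOK(x)_μ · HOK(y)_μ = (1/Λ) ∑_{t=1}^n ∑_{u=1}^n [ ζ₁ ∑_{k=1}^K exp(-(‖x_t - z_k‖² + ‖y_u - z_k‖²)/σ_k²) + ζ₂ ∑_{l=1}^L exp(-(((t:ℝ) - τ_l)² + ((u:ℝ)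 - τ_l)²)/s_l²) ]^r. -/
open Real

/-- The inner product of two sums of `r`-fold outer powers is the sum of the `r`-th powers of
the pairwise inner products. -/
theorem sum_outer_power_mul_sum_outer_power {ι κ α R : Type*} [Fintype ι] [Fintype κ] [Fintype α]
    [CommSemiring R] (r : ℕ) (f : ι → α → R) (g : κ → α → R) :
    ∑ μ : Fin r → α, (∑ t, ∏ j, f t (μ j)) * ∑ u, ∏ j, g u (μ j) =
      ∑ t, ∑ u, (∑ a, f t a * g u a) ^ r := by
  simp_rw [Fintype.sum_pow, Finset.prod_mul_distrib, Finset.sum_mul_sum]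
  rw [Finset.sum_comm]
  exact Finset.sum_congr rfl fun t _ => Finset.sum_comm

/-- The product of two weighted Gaussian features with a common bandwidth. -/
theorem sqrt_mul_exp_mul_sqrt_mul_exp {ζ : ℝ} (hζ : 0 ≤ ζ) (a b w : ℝ) :
    (Real.sqrt ζ * Real.exp (-a / w)) * (Real.sqrt ζ * Real.exp (-b / w)) =
      ζ * Real.exp (-(a + b) / w) := by
  rw [mul_mul_mul_comm, Real.mul_self_sqrt hζ, ← Real.exp_add]
  congr 2
  ring

/-- Definition 1 of the paper: the inner product of two HOK descriptors equals the
pivot-linearized sequence compatibility kernel of equation (7). Here `c x t` is the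
concatenation `[√ζ₁ Φ_F(x); √ζ₂ Φ_T(t)]` of weighted Gaussian feature maps on classifier
scores (pivots `z` with bandwidths `σ`) and on time steps (pivots `τ` with bandwidths `s`),
and `HOK(x) = (1/√Λ) ∑_t [√ζ₁ Φ_F(x_t); √ζ₂ Φ_T(t)]^{⊗r}`. -/
theorem hok_inner_eq_linearized_kernel
    (n d K L r : ℕ)
    (x y : Fin n → EuclideanSpace ℝ (Fin d))
    (z : Fin K → EuclideanSpace ℝ (Fin d)) (σ : Fin K → ℝ) (hσ : ∀ k, 0 < σ k)
    (τ : Fin L → ℝ) (s : Fin L → ℝ) (hs : ∀ l, 0 < s l)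
    (ζ₁ ζ₂ : ℝ) (hζ₁ : 0 ≤ ζ₁) (hζ₂ : 0 ≤ ζ₂) (Λ : ℝ) (hΛ : 0 < Λ)
    (c : EuclideanSpace ℝ (Fin d) → Fin n → Fin (K + L) → ℝ)
    (hc : ∀ v t, c v t =
      Fin.append
        (fun k : Fin K => Real.sqrt ζ₁ * Real.exp (-(‖v - z k‖ ^ 2) / (σ k) ^ 2))
        (fun l : Fin L => Real.sqrt ζ₂ * Real.exp (-(((t : ℝ) - τ l) ^ 2) / (s l) ^ 2)))
    (HOKx HOKy : (Fin r → Fin (K + L)) → ℝ)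
    (hHOKx : ∀ μ, HOKx μ = (1 / Real.sqrt Λ) * ∑ t : Fin n, ∏ j : Fin r, c (x t) t (μ j))
    (hHOKy : ∀ μ, HOKy μ = (1 / Real.sqrt Λ) * ∑ t : Fin n, ∏ j : Fin r, c (y t) t (μ j)) :
    ∑ μ : Fin r → Fin (K + L), HOKx μ * HOKy μ =
      (1 / Λ) * ∑ t : Fin n, ∑ u : Fin n,
        (ζ₁ * ∑ k : Fin K,
            Real.exp (-(‖x t - z k‖ ^ 2 + ‖y u - z k‖ ^ 2) / (σ k) ^ 2) +
         ζ₂ * ∑ l : Fin L,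
            Real.exp (-(((t : ℝ) - τ l) ^ 2 + ((u : ℝ) - τ l) ^ 2) / (s l) ^ 2)) ^ r := by
  have hscale (a b : ℝ) : (1 / Real.sqrt Λ * a) * (1 / Real.sqrt Λ * b) = 1 / Λ * (a * b) := by
    rw [mul_mul_mul_comm, one_div_mul_one_div_rev, Real.mul_self_sqrt hΛ.le]
  simp_rw [hHOKx, hHOKy, hscale, ← Finset.mul_sum]
  rw [sum_outer_power_mul_sum_outer_power r (fun t => c (x t) t) (fun u => c (y u) u)]
  simp_rw [hc, Fin.sum_univ_add, Fin.append_left, Fin.append_right,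
    sqrt_mul_exp_mul_sqrt_mul_exp hζ₁, sqrt_mul_exp_mul_sqrt_mul_exp hζ₂, Finset.mul_sum]
end
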